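/- Let (W,S) be a Coxeter system with S finite whose Coxeter diagram G (vertex set S, an edge {s,t} of weight m(s,t) whenever m(s,t) ≥ 3) is a tree in which exactly one edge {a,b} has weight M with 3 < M < ∞ and every other edge has weight 3. Then Γ_a ∩ Γ_a^{-1} consists exactly of the elements whose unique reduced words are the alternating words (a,b)_k for odd k with 0 < k < M, namely a, aba, ababa, and so on. -/

import Mathlib

/-!
Common definitions: alternating words, glued products, dihedral segment
decompositions, unique reduced words, and the subregular set `C`.
-/

/-- The alternating word `(s,t)_l = s t s ⋯` of length `l` beginning with `s`. -/
def altWord {B : Type*} (s t : B) : ℕ → List B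
  | 0 => []
  | k + 1 => s :: altWord t s k

/-- The glued product `x * y` of two words: the concatenation of `x` and `y` with one of the
two adjacent occurrences of the common letter deleted (intended for use when the last letter
of `x` equals the first letter of `y`). -/
def glueWord {B : Type*} (x y : List B) : List B := x ++ y.tail

/-- Iterated glued product `g₁ * g₂ * ⋯ * gₘ`. -/
def glueFold {B : Type*} : List (List B) → List B
  | [] => []
  | g :: rest => rest.foldl glueWord g

/-- `segs` is the list of dihedral segments of the word `x`: the maximal contiguous subwords of
`x` involving (at most) two distinct letters.  Each segment alternates in two distinct letters,
consecutive segments overlap in one letter (so that the glued product of the segments is `x`),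
and maximality is expressed by requiring that consecutive segments have different letter sets. -/
def IsDihedralDecomp {B : Type*} (x : List B) (segs : List (List B)) : Prop :=
  segs ≠ [] ∧
  (∀ seg ∈ segs, ∃ s t : B, s ≠ t ∧ seg ≠ [] ∧ seg = altWord s t seg.length) ∧
  (2 ≤ segs.length → ∀ seg ∈ segs, 2 ≤ seg.length) ∧
  segs.Chain' (fun u v => u.getLast? = v.head? ∧ ({a | a ∈ u} : Set B) ≠ {a | a ∈ v}) ∧
  x = glueFold segs

variable {B : Type*} {W : Type*} [Group W]

/-- `ω` is the unique reduced word of `w`. -/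
def IsUniqueReducedWord {M : CoxeterMatrix B} (cs : CoxeterSystem M W)
    (w : W) (ω : List B) : Prop :=
  cs.wordProd ω = w ∧ cs.IsReduced ω ∧
    ∀ ω' : List B, cs.wordProd ω' = w → cs.IsReduced ω' → ω' = ω

/-- The subregular set `C`: the non-identity elements of `W` admitting exactly one
reduced word. -/
def subregularSet {M : CoxeterMatrix B} (cs : CoxeterSystem M W) : Set W :=
  {w | w ≠ 1 ∧ ∃ ω : List B, IsUniqueReducedWord cs w ω}

/-- `Γ_s ∩ Γ_s⁻¹`: the elements of the subregular set whose unique reduced word both starts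
and ends with `s`. -/
def gammaSet {M : CoxeterMatrix B} (cs : CoxeterSystem M W) (s : B) : Set W :=
  {w | w ≠ 1 ∧ ∃ ω : List B, IsUniqueReducedWord cs w ω ∧
    ω.head? = some s ∧ ω.getLast? = some s}

/-! ### Alternating words -/

theorem length_altWord (s t : B) (k : ℕ) : (altWord s t k).length = k := by
  induction k generalizing s t with
  | zero => rfl
  | succ k ih => simp [altWord, ih]

theorem altWord_prefix_altWord (s t : B) {k n : ℕ} (h : k ≤ n) :
    altWord s t k <+: altWord s t n := by
  induction k generalizing s t n with
  | zero => exact List.nil_prefix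
  | succ k ih =>
    obtain ⟨n, rfl⟩ : ∃ n', n = n' + 1 := ⟨n - 1, by omega⟩
    simpa [altWord, List.cons_prefix_cons] using ih t s (by omega)

theorem getLast?_altWord_succ (s t : B) (k : ℕ) :
    (altWord s t (k + 1)).getLast? = some (if Even k then s else t) := by
  induction k generalizing s t with
  | zero => simp [altWord]
  | succ k ih =>
    rw [altWord, List.getLast?_cons, ih t s]
    by_cases h : Even k <;> simp [h, Nat.even_add_one, -Nat.not_even_iff_odd]

theorem reverse_alternatingWord (i j : B) (k : ℕ) :
    (CoxeterSystem.alternatingWord i j k).reverse = altWord j i k := by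
  induction k generalizing i j with
  | zero => rfl
  | succ k ih => simp [CoxeterSystem.alternatingWord_succ, altWord, ih]

theorem wordProd_altWord_coxeterMatrix_eq {M : CoxeterMatrix B} (cs : CoxeterSystem M W) (s t : B) :
    cs.wordProd (altWord s t (M s t)) = cs.wordProd (altWord t s (M s t)) := by
  have h := cs.wordProd_braidWord_eq s t
  rw [CoxeterSystem.braidWord, CoxeterSystem.braidWord, ← M.symmetric s t] at h
  rw [← reverse_alternatingWord, ← reverse_alternatingWord, cs.wordProd_reverse,
    cs.wordProd_reverse, h]

theorem leftInvSeq_altWord {M : CoxeterMatrix B} (cs : CoxeterSystem M W) (i j : B) (k : ℕ) :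
    cs.leftInvSeq (altWord i j k) =
      (List.range k).map fun p => (cs.simple i * cs.simple j) ^ p * cs.simple i := by
  induction k generalizing i j with
  | zero => rfl
  | succ k ih =>
    rw [altWord, CoxeterSystem.leftInvSeq, ih, List.range_succ_eq_map, List.map_cons,
      List.map_map, List.map_map]
    simp only [pow_zero, one_mul, List.cons.injEq, true_and]
    refine List.map_congr_left fun p _ => ?_
    simp only [Function.comp_apply, MulAut.conj_apply, cs.inv_simple, Nat.succ_eq_add_one]
    rw [pow_succ', mul_pow_mul]
    simp only [mul_assoc, mul_pow_mul]

/-! ### Parity of multiplicities in inversion sequences -/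

section Parity

open Classical in
/-- The involution `(x, ε) ↦ (s x s, ε + [x = s])` of `W × ZMod 2` attached to `s`. -/
noncomputable def invParityPerm (s : W) (hs : s * s = 1) : Equiv.Perm (W × ZMod 2) :=
  Function.Involutive.toPerm
    (fun q => (s * q.1 * s, q.2 + if q.1 = s then 1 else 0)) (by
      rintro ⟨x, ε⟩
      have h : s * x * s = s ↔ x = s := by
        constructor
        · intro h
          have := congrArg (fun y => s * y * s) h
          simpa [mul_assoc, hs, ← mul_assoc s s] using this
        · rintro rfl
          simp [hs]
      have h2 : s * (s * x * s) * s = x := by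
        simp [mul_assoc, hs, ← mul_assoc s s]
      have h3 : (1 : ZMod 2) + 1 = 0 := by decide
      simp only [h, h2, Prod.mk.injEq, true_and]
      split_ifs <;> simp [add_assoc, h3])

variable {M : CoxeterMatrix B} (cs : CoxeterSystem M W)

open Classical in
theorem prod_map_reverse_invParityPerm_apply (ω : List B) (x : W) (ε : ZMod 2) :
    (ω.reverse.map fun i => invParityPerm (cs.simple i) (cs.simple_mul_simple_self i)).prod (x, ε) =
      ((cs.wordProd ω)⁻¹ * x * cs.wordProd ω, ε + ((cs.leftInvSeq ω).count x : ZMod 2)) := by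
  induction ω generalizing x ε with
  | nil => simp
  | cons i ω ih =>
    have hc : ((cs.leftInvSeq ω).map (MulAut.conj (cs.simple i))).count x =
        (cs.leftInvSeq ω).count (cs.simple i * x * cs.simple i) := by
      have hx : x = MulAut.conj (cs.simple i) (cs.simple i * x * cs.simple i) := by
        simp [mul_assoc]
      conv_lhs => rw [hx]
      exact List.count_map_of_injective _ _ (MulAut.conj (cs.simple i)).injective _
    have happ : invParityPerm (cs.simple i) (cs.simple_mul_simple_self i) (x, ε) =
        (cs.simple i * x * cs.simple i, ε + if x = cs.simple i then 1 else 0) := rfl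
    rw [List.reverse_cons, List.map_append, List.prod_append, Equiv.Perm.mul_apply,
      List.map_singleton, List.prod_singleton, happ, ih, CoxeterSystem.leftInvSeq, List.count_cons,
      hc, cs.wordProd_cons]
    refine Prod.ext ?_ ?_
    · simp [mul_assoc]
    · simp only [beq_iff_eq, eq_comm (a := x)]
      split_ifs <;> simp [add_comm, add_left_comm]

theorem isLiftable_invParityPerm :
    M.IsLiftable fun i => invParityPerm (cs.simple i) (cs.simple_mul_simple_self i) := by
  classical
  intro i j
  have hpow : ∀ m, ((altWord j i (2 * m)).reverse.map fun i =>
      invParityPerm (cs.simple i) (cs.simple_mul_simple_self i)).prod =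
      (invParityPerm (cs.simple i) (cs.simple_mul_simple_self i) *
        invParityPerm (cs.simple j) (cs.simple_mul_simple_self j)) ^ m := by
    intro m
    induction m with
    | zero => simp [altWord]
    | succ m ih => simp [Nat.mul_succ, altWord, pow_succ, ← ih]
  have hword : ∀ m, cs.wordProd (altWord j i (2 * m)) = (cs.simple j * cs.simple i) ^ m := by
    intro m
    induction m with
    | zero => simp [altWord]
    | succ m ih => simp [Nat.mul_succ, altWord, pow_succ', ← ih, cs.wordProd_cons, mul_assoc]
  rw [← hpow]
  ext1 ⟨x, ε⟩
  rw [prod_map_reverse_invParityPerm_apply, hword, cs.simple_mul_simple_pow', leftInvSeq_altWord,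
    two_mul, List.range_add, List.map_append, List.map_map, List.count_append]
  have hper : ((fun p => (cs.simple j * cs.simple i) ^ p * cs.simple j) ∘ fun p => M i j + p) =
      fun p => (cs.simple j * cs.simple i) ^ p * cs.simple j := by
    funext p
    simp [pow_add]
  rw [hper]
  have h2 : ∀ z : ZMod 2, z + z = 0 := by decide
  simp [h2]

open Classical in
/-- The parity of the multiplicity of `x` in the left inversion sequence of a word only depends on
the product of the word. -/
theorem count_leftInvSeq_cast_eq {ω ω' : List B} (h : cs.wordProd ω = cs.wordProd ω') (x : W) :
    ((cs.leftInvSeq ω).count x : ZMod 2) = ((cs.leftInvSeq ω').count x : ZMod 2) := by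
  have key : ∀ ω : List B,
      cs.lift ⟨_, isLiftable_invParityPerm cs⟩ (cs.wordProd ω)⁻¹ (x, 0) =
        ((cs.wordProd ω)⁻¹ * x * cs.wordProd ω, ((cs.leftInvSeq ω).count x : ZMod 2)) := by
    intro ω
    have hlift : cs.lift ⟨_, isLiftable_invParityPerm cs⟩ (cs.wordProd ω)⁻¹ =
        (ω.reverse.map fun i =>
          invParityPerm (cs.simple i) (cs.simple_mul_simple_self i)).prod := by
      rw [← cs.wordProd_reverse, CoxeterSystem.wordProd, map_list_prod, List.map_map]
      congr 2
      funext i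
      exact cs.lift_apply_simple (isLiftable_invParityPerm cs) i
    rw [hlift, prod_map_reverse_invParityPerm_apply, zero_add]
  have h1 := key ω
  rw [h, key ω'] at h1
  exact (congrArg Prod.snd h1).symm

theorem mem_leftInvSeq_of_nodup {ω ω' : List B} (h : cs.wordProd ω = cs.wordProd ω')
    (hω : (cs.leftInvSeq ω).Nodup) {x : W} (hx : x ∈ cs.leftInvSeq ω) :
    x ∈ cs.leftInvSeq ω' := by
  classical
  have h1 := count_leftInvSeq_cast_eq cs h x
  rw [List.count_eq_one_of_mem hω hx] at h1
  by_contra hx'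
  rw [List.count_eq_zero_of_not_mem hx'] at h1
  exact absurd h1 (by decide)

end Parity

/-! ### The geometric representation -/

section Geometric

open Real Polynomial.Chebyshev

/-- The entries `-2 cos (π / M i j)` of the Cartan matrix of a Coxeter matrix. -/
noncomputable def CoxeterMatrix.cartan (M : CoxeterMatrix B) (i j : B) : ℝ :=
  -2 * cos (π / M i j)

/-- The simple coroot, as a functional on `B →₀ ℝ`. -/
noncomputable def CoxeterMatrix.coroot (M : CoxeterMatrix B) (i : B) : Module.Dual ℝ (B →₀ ℝ) :=
  Finsupp.linearCombination ℝ (M.cartan i)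

variable (M : CoxeterMatrix B)

theorem CoxeterMatrix.coroot_single (i j : B) :
    M.coroot i (Finsupp.single j 1) = M.cartan i j := by
  simp [CoxeterMatrix.coroot]

theorem CoxeterMatrix.coroot_single_self (i : B) : M.coroot i (Finsupp.single i 1) = 2 := by
  simp [CoxeterMatrix.coroot_single, CoxeterMatrix.cartan]

/-- The simple reflections of the geometric representation. -/
noncomputable def CoxeterMatrix.geomReflection (i : B) : (B →₀ ℝ) ≃ₗ[ℝ] (B →₀ ℝ) :=
  Module.reflection (M.coroot_single_self i)

theorem CoxeterMatrix.cartan_comm (i j : B) : M.cartan i j = M.cartan j i := by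
  rw [CoxeterMatrix.cartan, CoxeterMatrix.cartan, M.symmetric]

theorem CoxeterMatrix.coroot_mul_coroot_sub_two (i j : B) :
    M.coroot i (Finsupp.single j 1) * M.coroot j (Finsupp.single i 1) - 2 =
      2 * cos (2 * π / M i j) := by
  rw [M.coroot_single, M.coroot_single, M.cartan_comm j i, CoxeterMatrix.cartan, mul_div_assoc,
    cos_two_mul]
  ring

theorem sin_two_pi_div_pos {m : ℕ} (hm : 3 ≤ m) : 0 < sin (2 * π / m) := by
  have hm' : (3 : ℝ) ≤ m := by exact_mod_cast hm
  apply sin_pos_of_pos_of_lt_pi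
  · positivity
  · rw [div_lt_iff₀ (by linarith)]
    nlinarith [pi_pos]

theorem CoxeterMatrix.isLiftable_geomReflection : M.IsLiftable M.geomReflection := by
  intro i j
  by_cases hij : i = j
  · subst hij
    rw [M.diagonal, pow_one, CoxeterMatrix.geomReflection]
    ext1 z
    exact Module.involutive_reflection (M.coroot_single_self i) z
  obtain h0 | h2 | h3 : M i j = 0 ∨ M i j = 2 ∨ 3 ≤ M i j := by
    have := M.off_diagonal i j hij
    omega
  · rw [h0, pow_zero]
  · have hA : M.cartan i j = 0 := by simp [CoxeterMatrix.cartan, h2]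
    have hA' : M.cartan j i = 0 := by rw [M.cartan_comm, hA]
    have hB : M.coroot i (Finsupp.single j 1) = 0 := by rw [M.coroot_single, hA]
    have hB' : M.coroot j (Finsupp.single i 1) = 0 := by rw [M.coroot_single, hA']
    refine LinearEquiv.ext fun z => ?_
    rw [h2]
    simp only [CoxeterMatrix.geomReflection, pow_two, LinearEquiv.mul_apply,
      Module.reflection_apply, map_sub, map_smul, M.coroot_single_self, hB, hB',
      LinearEquiv.coe_one, id_eq]
    module
  · refine LinearEquiv.ext fun z => ?_
    have hsin := (sin_two_pi_div_pos h3).ne'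
    have hm0 : (M i j : ℝ) ≠ 0 := by
      have : M i j ≠ 0 := by omega
      exact_mod_cast this
    have hS := fun n : ℤ => S_two_mul_real_cos (2 * π / M i j) n
    rw [CoxeterMatrix.geomReflection, CoxeterMatrix.geomReflection,
      Module.reflection_mul_reflection_pow_apply _ _ _ _ _ (M.coroot_mul_coroot_sub_two i j).symm,
      LinearEquiv.coe_one, id_eq]
    obtain ⟨k, hk | hk⟩ := Nat.even_or_odd' (M i j)
    · have e1 : ((M i j : ℤ) - 2) / 2 = k - 1 := by omega
      have e2 : ((M i j : ℤ) - 1) / 2 = k - 1 := by omega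
      have hz : (S ℝ ((k : ℤ) - 1)).eval (2 * cos (2 * π / M i j)) = 0 := by
        refine (mul_eq_zero.mp ((hS _).trans ?_)).resolve_right hsin
        have : (((k : ℤ) - 1 : ℤ) + 1 : ℝ) * (2 * π / M i j) = π := by
          have hk' : (M i j : ℝ) = 2 * k := by exact_mod_cast hk
          push_cast
          field_simp
          rw [hk']
          ring
        rw [this, sin_pi]
      rw [e1, e2, hz]
      simp
    · have e1 : ((M i j : ℤ) - 2) / 2 = k - 1 := by omega
      have e2 : ((M i j : ℤ) - 1) / 2 = k := by omega
      have e3 : ((M i j : ℤ) - 3) / 2 = k - 1 := by omega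
      have e4 : (M i j : ℤ) / 2 = k := by omega
      have hz : (S ℝ (k : ℤ)).eval (2 * cos (2 * π / M i j)) +
          (S ℝ ((k : ℤ) - 1)).eval (2 * cos (2 * π / M i j)) = 0 := by
        refine (mul_eq_zero.mp (?_ : _ * sin (2 * π / M i j) = 0)).resolve_right hsin
        rw [add_mul, hS, hS]
        have : (((k : ℤ) : ℝ) + 1) * (2 * π / M i j) =
            2 * π - (((k : ℤ) - 1 : ℤ) + 1 : ℝ) * (2 * π / M i j) := by
          have hk' : (M i j : ℝ) = 2 * k + 1 := by exact_mod_cast hk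
          push_cast
          field_simp
          rw [hk']
          ring
        rw [this, sin_two_pi_sub]
        ring
      rw [e1, e2, e3, e4, hz]
      simp

theorem CoxeterMatrix.geomReflection_mul_pow_ne_one {i j : B} (hij : i ≠ j) (hm : 3 ≤ M i j)
    {n : ℕ} (hn : 0 < n) (hnm : n < M i j) :
    (M.geomReflection i * M.geomReflection j) ^ n ≠ 1 := by
  intro h
  have hsin := sin_two_pi_div_pos hm
  have hm' : (3 : ℝ) ≤ M i j := by exact_mod_cast hm
  have hS := fun n : ℤ => S_two_mul_real_cos (2 * π / M i j) n
  have hA : M.cartan j i ≠ 0 := by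
    rw [M.cartan_comm, CoxeterMatrix.cartan]
    have : 0 < cos (π / M i j) := by
      apply cos_pos_of_mem_Ioo
      constructor
      · have : 0 < π / M i j := by positivity
        linarith [pi_pos]
      · exact div_lt_div_of_pos_left pi_pos (by norm_num) (by linarith)
    linarith
  have h1 := Module.reflection_mul_reflection_pow_apply_self (M.coroot_single_self i)
    (M.coroot_single_self j) n _ (M.coroot_mul_coroot_sub_two i j).symm
  rw [show Module.reflection (M.coroot_single_self i) = M.geomReflection i from rfl,
    show Module.reflection (M.coroot_single_self j) = M.geomReflection j from rfl, h,
    LinearEquiv.coe_one, id_eq] at h1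
  have hi := congrArg (fun v : B →₀ ℝ => v i) h1
  have hj := congrArg (fun v : B →₀ ℝ => v j) h1
  simp [hij, hij.symm, M.coroot_single, hA] at hi hj
  rw [hj, add_zero] at hi
  have e1 := hS (n - 1)
  rw [hj, zero_mul] at e1
  have e2 := hS n
  rw [← hi, one_mul] at e2
  push_cast at e1 e2
  rw [sub_add_cancel] at e1
  rw [add_mul, one_mul, sin_add, ← e1, zero_mul, zero_add] at e2
  have hc : cos (n * (2 * π / M i j)) = 1 := by
    have := mul_right_cancel₀ hsin.ne' ((one_mul _).trans e2)
    exact this.symm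
  have hn' : (0 : ℝ) < n := by exact_mod_cast hn
  have hnm' : (n : ℝ) < M i j := by exact_mod_cast hnm
  have hlt : n * (2 * π / M i j) < 2 * π := by
    rw [← mul_div_assoc, div_lt_iff₀ (by linarith)]
    nlinarith [pi_pos]
  have hpos : 0 < n * (2 * π / M i j) := by positivity
  rw [cos_eq_one_iff_of_lt_of_lt (by linarith [pi_pos]) hlt] at hc
  exact hpos.ne' hc

end Geometric

/-! ### Alternating words are unique reduced words -/

section AltWord

variable {M : CoxeterMatrix B} (cs : CoxeterSystem M W)

theorem lift_geomReflection_simple (i : B) :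
    cs.lift ⟨_, M.isLiftable_geomReflection⟩ (cs.simple i) = M.geomReflection i :=
  cs.lift_apply_simple M.isLiftable_geomReflection i

theorem simple_mul_simple_pow_ne_one {i j : B} (hij : i ≠ j) (hm : 3 ≤ M i j)
    {n : ℕ} (hn : 0 < n) (hnm : n < M i j) : (cs.simple i * cs.simple j) ^ n ≠ 1 := by
  intro h
  apply M.geomReflection_mul_pow_ne_one hij hm hn hnm
  have := congrArg (cs.lift ⟨_, M.isLiftable_geomReflection⟩) h
  simpa only [map_pow, map_mul, lift_geomReflection_simple, map_one] using this

theorem geomReflection_apply_of_ne {c i : B} (h : c ≠ i) (v : B →₀ ℝ) :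
    M.geomReflection i v c = v c := by
  simp [CoxeterMatrix.geomReflection, Module.reflection_apply, h]

theorem simple_ne_mul_pow_mul_simple {i j c : B} (hi : c ≠ i) (hj : c ≠ j) (p : ℕ) :
    cs.simple c ≠ (cs.simple i * cs.simple j) ^ p * cs.simple i := by
  intro h
  have h1 := congrArg (cs.lift ⟨_, M.isLiftable_geomReflection⟩) h
  simp only [map_pow, map_mul, lift_geomReflection_simple] at h1
  have h2 := congrArg (fun f : (B →₀ ℝ) ≃ₗ[ℝ] (B →₀ ℝ) => f (Finsupp.single c 1) c) h1
  have hfix : ∀ (p : ℕ) (v : B →₀ ℝ),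
      ((M.geomReflection i * M.geomReflection j) ^ p) v c = v c := by
    intro p
    induction p with
    | zero => simp
    | succ p ih =>
      intro v
      rw [pow_succ, LinearEquiv.mul_apply, ih, LinearEquiv.mul_apply,
        geomReflection_apply_of_ne hi, geomReflection_apply_of_ne hj]
  simp only [LinearEquiv.mul_apply, hfix, geomReflection_apply_of_ne hi] at h2
  simp only [CoxeterMatrix.geomReflection, Module.reflection_apply_self] at h2
  norm_num at h2

theorem nodup_leftInvSeq_altWord {i j : B} (hij : i ≠ j) (hm : 3 ≤ M i j) {k : ℕ}
    (hk : k < M i j) : (cs.leftInvSeq (altWord i j k)).Nodup := by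
  rw [leftInvSeq_altWord]
  refine List.Nodup.map_on ?_ List.nodup_range
  have key : ∀ p q : ℕ, p < q → q < k →
      (cs.simple i * cs.simple j) ^ p ≠ (cs.simple i * cs.simple j) ^ q := by
    intro p q hpq hq h
    obtain ⟨d, rfl⟩ := Nat.exists_eq_add_of_lt hpq
    rw [add_assoc, pow_add, eq_comm, mul_eq_left] at h
    exact simple_mul_simple_pow_ne_one cs hij hm (by omega) (by omega) h
  intro p hp q hq h
  have h' := mul_right_cancel h
  rw [List.mem_range] at hp hq
  rcases lt_trichotomy p q with hpq | hpq | hpq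
  · exact absurd h' (key p q hpq hq)
  · exact hpq
  · exact absurd h'.symm (key q p hpq hp)

theorem isReduced_altWord {i j : B} (hij : i ≠ j) (hm : 3 ≤ M i j) {k : ℕ} (hk : k < M i j) :
    cs.IsReduced (altWord i j k) := by
  obtain ⟨ω, hω, h⟩ := cs.exists_isReduced (cs.wordProd (altWord i j k))
  have hnd := nodup_leftInvSeq_altWord cs hij hm hk
  have hle : (cs.leftInvSeq (altWord i j k)).length ≤ (cs.leftInvSeq ω).length :=
    (hnd.subperm fun x hx => mem_leftInvSeq_of_nodup cs h hnd hx).length_le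
  rw [cs.length_leftInvSeq, cs.length_leftInvSeq] at hle
  have hω' : cs.length (cs.wordProd ω) = ω.length := hω
  exact le_antisymm (cs.length_wordProd_le _) (by rw [h, hω']; exact hle)

theorem eq_altWord_of_isReduced {i j : B} (hij : i ≠ j) (hm : 3 ≤ M i j) {k : ℕ} (hk : k < M i j)
    {ω : List B} (h : cs.wordProd ω = cs.wordProd (altWord i j k)) (hω : cs.IsReduced ω) :
    ω = altWord i j k := by
  induction k generalizing i j ω with
  | zero =>
    have : cs.length (cs.wordProd ω) = ω.length := hω
    rw [h] at this
    simpa [altWord, eq_comm] using this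
  | succ k ih =>
    have hlen : ω.length = k + 1 := by
      have h1 : cs.length (cs.wordProd ω) = ω.length := hω
      have h2 : cs.length (cs.wordProd _) = _ := isReduced_altWord cs hij hm hk
      rw [← h1, h, h2, length_altWord]
    obtain ⟨c, ω, rfl⟩ := List.exists_cons_of_length_eq_add_one hlen
    have hmem : cs.simple c ∈ cs.leftInvSeq (altWord i j (k + 1)) :=
      mem_leftInvSeq_of_nodup cs h hω.nodup_leftInvSeq (by simp [CoxeterSystem.leftInvSeq])
    rw [leftInvSeq_altWord, List.mem_map] at hmem
    obtain ⟨p, hp, hpc⟩ := hmem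
    rw [List.mem_range] at hp
    have hci : c = i := by
      by_contra hci
      by_cases hcj : c = j
      · subst hcj
        apply simple_mul_simple_pow_ne_one cs hij hm (Nat.succ_pos p) (by omega)
        rw [Nat.succ_eq_add_one, pow_succ, ← mul_assoc, hpc, cs.simple_mul_simple_self]
      · exact simple_ne_mul_pow_mul_simple cs hci hcj p hpc.symm
    subst hci
    rw [altWord, cs.wordProd_cons, cs.wordProd_cons] at h
    rw [altWord, ih hij.symm (by rwa [M.symmetric]) (by rw [M.symmetric]; omega)
      (mul_left_cancel h) (by simpa using hω.drop 1)]

theorem isUniqueReducedWord_altWord {i j : B} (hij : i ≠ j) (hm : 3 ≤ M i j) {k : ℕ}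
    (hk : k < M i j) :
    IsUniqueReducedWord cs (cs.wordProd (altWord i j k)) (altWord i j k) :=
  ⟨rfl, isReduced_altWord cs hij hm hk, fun _ h hω => eq_altWord_of_isReduced cs hij hm hk h hω⟩

end AltWord

/-! ### Subwords of unique reduced words -/

section Subwords

variable {M : CoxeterMatrix B} {cs : CoxeterSystem M W} {w : W} {ω : List B}

theorem IsUniqueReducedWord.not_altWord_infix (h : IsUniqueReducedWord cs w ω) {s t : B}
    (hst : s ≠ t) (hm : M s t ≠ 0) : ¬ altWord s t (M s t) <:+: ω := by
  rintro ⟨u, v, rfl⟩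
  obtain ⟨hw, hr, hu⟩ := h
  have hprod : cs.wordProd (u ++ altWord t s (M s t) ++ v) =
      cs.wordProd (u ++ altWord s t (M s t) ++ v) := by
    simp only [cs.wordProd_append, wordProd_altWord_coxeterMatrix_eq cs s t]
  have hlen : (u ++ altWord t s (M s t) ++ v).length =
      (u ++ altWord s t (M s t) ++ v).length := by
    simp only [List.length_append, length_altWord]
  have heq := hu _ (hprod.trans hw) (by rw [CoxeterSystem.IsReduced, hprod, hlen]; exact hr)
  have heq' := List.append_cancel_left (List.append_cancel_right heq)
  obtain ⟨n, hn⟩ := Nat.exists_eq_succ_of_ne_zero hm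
  rw [hn, altWord, altWord, List.cons.injEq] at heq'
  exact hst heq'.1.symm

theorem IsUniqueReducedWord.not_pair_infix (h : IsUniqueReducedWord cs w ω) (s : B) :
    ¬ [s, s] <:+: ω := by
  rintro ⟨u, v, rfl⟩
  have hprod : cs.wordProd (u ++ [s, s] ++ v) = cs.wordProd (u ++ v) := by
    simp [cs.wordProd_append, cs.wordProd_cons]
  have hr : cs.length (cs.wordProd _) = _ := h.2.1
  have hle := cs.length_wordProd_le (u ++ v)
  rw [← hprod, hr] at hle
  simp at hle

end Subwords

/-! ### Non-backtracking walks in acyclic graphs -/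

section Walks

variable {G : SimpleGraph B}

theorem SimpleGraph.IsAcyclic.getLast_ne_of_isPath (hG : G.IsAcyclic) {a b : B} (hab : G.Adj a b)
    (l : List B) {x y : B} (p : G.Walk a y) (hp : p.IsPath) (hpx : p.penultimate = x)
    (hya : y ≠ a) (hyb : y ≠ b) (hadj : ∀ s t, [s, t] <:+: x :: y :: l → G.Adj s t)
    (hback : ∀ s t, [s, t, s] <:+: x :: y :: l → t = a ∨ t = b) :
    (y :: l).getLast (by simp) ≠ a ∧ (y :: l).getLast (by simp) ≠ b := by
  induction l generalizing x y with
  | nil => exact ⟨hya, hyb⟩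
  | cons z l ih =>
    have hyz : G.Adj y z := hadj y z ⟨[x], l, rfl⟩
    have hzx : z ≠ x := by
      rintro rfl
      rcases hback z y ⟨[], l, rfl⟩ with h | h
      exacts [hya h, hyb h]
    have hz : z ∉ p.support := fun h => hzx ((hG.eq_penultimate_of_adj_end hp hyz h).trans hpx)
    have hza : z ≠ a := by
      rintro rfl
      exact hz p.start_mem_support
    have hq : (p.concat hyz).IsPath := hp.concat hz hyz
    have hzb : z ≠ b := by
      rintro rfl
      have := hG.eq_penultimate_of_adj_end hq hab.symm (p.concat hyz).start_mem_support
      rw [SimpleGraph.Walk.penultimate_concat] at this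
      exact hya this.symm
    rw [List.getLast_cons (by simp)]
    refine ih (p.concat hyz) hq (p.penultimate_concat hyz) hza hzb (fun s t h => hadj s t ?_)
      (fun s t h => hback s t ?_)
    · exact h.trans (List.suffix_cons x _).isInfix
    · exact h.trans (List.suffix_cons x _).isInfix

theorem SimpleGraph.IsAcyclic.eq_altWord (hG : G.IsAcyclic) {a b : B} (hab : G.Adj a b)
    (l : List B) (hadj : ∀ s t, [s, t] <:+: a :: l → G.Adj s t)
    (hback : ∀ s t, [s, t, s] <:+: a :: l → t = a ∨ t = b)
    (hlast : (a :: l).getLast (by simp) = a ∨ (a :: l).getLast (by simp) = b) :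
    a :: l = altWord a b (l.length + 1) := by
  induction l generalizing a b with
  | nil => rfl
  | cons z l ih =>
    have haz : G.Adj a z := hadj a z ⟨[], l, rfl⟩
    rw [List.getLast_cons (by simp)] at hlast
    by_cases hzb : z = b
    · subst hzb
      rw [altWord, List.length_cons, ← ih hab.symm
        (fun s t h => hadj s t (h.trans (List.suffix_cons a _).isInfix))
        (fun s t h => (hback s t (h.trans (List.suffix_cons a _).isInfix)).symm) hlast.symm]
    · have := hG.getLast_ne_of_isPath hab l haz.toWalk (by simp [haz.ne]) (by simp) haz.ne'
        hzb hadj hback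
      exact absurd hlast (by tauto)

end Walks

/-- If `S` is finite and the Coxeter diagram is a tree with exactly one edge `{a,b}` of weight
`Mv` satisfying `3 < Mv < ∞` while all other edges have weight `3`, then `Γ_a ∩ Γ_a⁻¹`
consists exactly of the elements whose unique reduced words are the alternating words
`(a,b)_k` for odd `k` with `0 < k < Mv`. -/
theorem gammaSet_of_one_heavy_edge_tree {M : CoxeterMatrix B} (cs : CoxeterSystem M W)
    [Fintype B] (a b : B) (hab : a ≠ b) (Mv : ℕ) (hMv : 3 < Mv) (hMab : M a b = Mv)
    (hother : ∀ s t : B, s ≠ t → ¬(s = a ∧ t = b) → ¬(s = b ∧ t = a) →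
      M s t = 2 ∨ M s t = 3)
    (htree : (SimpleGraph.fromRel (fun s t : B => M s t = 0 ∨ 3 ≤ M s t)).IsTree) :
    (∀ k : ℕ, Odd k → k < Mv →
      IsUniqueReducedWord cs (cs.wordProd (altWord a b k)) (altWord a b k)) ∧
    gammaSet cs a =
      {w : W | ∃ k : ℕ, Odd k ∧ k < Mv ∧ IsUniqueReducedWord cs w (altWord a b k)} := by
  have hm3 : 3 ≤ M a b := by omega
  have huniq : ∀ k : ℕ, k < Mv →
      IsUniqueReducedWord cs (cs.wordProd (altWord a b k)) (altWord a b k) :=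
    fun k hk => isUniqueReducedWord_altWord cs hab hm3 (by omega)
  refine ⟨fun k _ hk => huniq k hk, Set.ext fun w => ⟨?_, ?_⟩⟩
  · rintro ⟨-, ω, hω, hhead, hlast⟩
    obtain ⟨l, rfl⟩ : ∃ l, ω = a :: l := by
      cases ω with
      | nil => simp at hhead
      | cons c l => exact ⟨l, by simp_all⟩
    have heq : a :: l = altWord a b (l.length + 1) := by
      refine htree.isAcyclic.eq_altWord ?_ l ?_ ?_ (Or.inl ?_)
      · exact (SimpleGraph.fromRel_adj _ _ _).mpr ⟨hab, Or.inl (Or.inr hm3)⟩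
      · intro s t h
        have hst : s ≠ t := by
          rintro rfl
          exact hω.not_pair_infix s h
        have h2 : M s t ≠ 2 := by
          intro h2
          refine hω.not_altWord_infix hst (by omega) ?_
          rw [h2]
          exact h
        have h1 := M.off_diagonal s t hst
        exact (SimpleGraph.fromRel_adj _ _ _).mpr ⟨hst, Or.inl (by omega)⟩
      · intro s t h
        have h' : [s, t] <:+: [s, t, s] := ⟨[], [s], rfl⟩
        have hst : s ≠ t := by
          rintro rfl
          exact hω.not_pair_infix s (h'.trans h)
        by_contra hcon
        rcases hother s t hst (by tauto) (by tauto) with h2 | h3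
        · refine hω.not_altWord_infix hst (by omega) ?_
          rw [h2]
          exact h'.trans h
        · refine hω.not_altWord_infix hst (by omega) ?_
          rw [h3]
          exact h
      · rw [List.getLast?_eq_some_getLast (by simp)] at hlast
        simpa using hlast
    rw [heq] at hω hlast
    refine ⟨l.length + 1, ?_, ?_, hω⟩
    · rw [getLast?_altWord_succ] at hlast
      by_contra hodd
      rw [if_neg (by grind)] at hlast
      exact hab (Option.some.inj hlast).symm
    · by_contra hle
      exact hω.not_altWord_infix hab (by omega)
        (altWord_prefix_altWord a b (by omega : M a b ≤ l.length + 1)).isInfix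
  · rintro ⟨k, hk, hkM, hω⟩
    obtain ⟨n, rfl⟩ : ∃ n, k = n + 1 := ⟨k - 1, by have := hk.pos; omega⟩
    refine ⟨?_, _, hω, rfl, ?_⟩
    · rintro rfl
      have h : cs.length (cs.wordProd _) = _ := hω.2.1
      rw [hω.1, length_altWord, cs.length_one] at h
      omega
    · rw [getLast?_altWord_succ, if_pos (by grind)]
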